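/- arXiv:1703.05483 — 2 statements merged into one kernel-verified Lean document; each statement's English description precedes it below -/
import Mathlib

section
/- Suppose P_U = ∅ and μ_{kℓ} = μ_ℓ for all (k,ℓ) ∈ E(P), i.e., the jump constant depends only on the destination subsystem. If σ satisfies mode-dependent average dwell times, i.e., for every j ∈ P there exist N_0^j > 0 and τ_a^j > 0 with N_j(s,t) ≤ N_0^j + T_j(s,t)/τ_a^j for every 0 ≤ s < t, and τ_a^j > (ln μ_j)/λ_j for every j ∈ P, then condition (★) holds: limsup_{t→+∞} ( ν(t) · Σ_{(k,ℓ)∈E(P)} (ln μ_{kℓ}) ρ_{kℓ}(t) − Σ_{j∈P_S} |λ_j| η_j(t) ) < 0. -/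
open Filter MeasureTheory Set

noncomputable section

/-- A switching signal: strictly increasing switching instants `tau 0 = 0 < tau 1 < ...`
tending to `+∞`, together with the signal `sig` itself, constant on `[tau i, tau (i+1))`
and actually switching at each `tau (i+1)`. -/
structure SwitchSig (P : Type*) where
  tau : ℕ → ℝ
  sig : ℝ → P
  tau0 : tau 0 = 0
  mono : StrictMono tau
  tends : Filter.Tendsto tau Filter.atTop Filter.atTop
  const : ∀ i : ℕ, ∀ t : ℝ, tau i ≤ t → t < tau (i + 1) → sig t = sig (tau i)
  switch : ∀ i : ℕ, sig (tau i) ≠ sig (tau (i + 1))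

namespace SwitchSig

variable {P : Type*} (S : SwitchSig P)

/-- `N s t` : the number of switching instants in `(s, t]`. -/
def N (s t : ℝ) : ℕ := Set.ncard {i : ℕ | s < S.tau i ∧ S.tau i ≤ t}

/-- `Ntrans k l t` : the number of transitions from `k` to `l` occurring up to time `t`. -/
def Ntrans (k l : P) (t : ℝ) : ℕ :=
  Set.ncard {i : ℕ | S.tau (i + 1) ≤ t ∧ S.sig (S.tau i) = k ∧ S.sig (S.tau (i + 1)) = l}

/-- `Nmode j s t` : the number of switching instants in `(s, t]` at which subsystem `j`
is activated. -/
def Nmode (j : P) (s t : ℝ) : ℕ :=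
  Set.ncard {i : ℕ | s < S.tau i ∧ S.tau i ≤ t ∧ S.sig (S.tau i) = j}

/-- `T j s t` : the total duration of activation of subsystem `j` on `(s, t]`
(Lebesgue measure). -/
def T (j : P) (s t : ℝ) : ℝ :=
  (MeasureTheory.volume {r : ℝ | s < r ∧ r ≤ t ∧ S.sig r = j}).toReal

/-- switching frequency `ν(t) = N(0,t)/t`. -/
def nu (t : ℝ) : ℝ := (S.N 0 t : ℝ) / t

/-- transition frequency `ρ_{kl}(t) = N_{kl}(0,t)/N(0,t)`. -/
def rho (k l : P) (t : ℝ) : ℝ := (S.Ntrans k l t : ℝ) / (S.N 0 t : ℝ)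

/-- fraction of activation `η_j(t) = T_j(0,t)/t`. -/
def eta (j : P) (t : ℝ) : ℝ := S.T j 0 t / t

end SwitchSig

namespace SwitchSig

variable {P : Type*} (S : SwitchSig P)

theorem finite_setOf_tau_le (t : ℝ) : {i : ℕ | S.tau i ≤ t}.Finite := by
  obtain ⟨M, hM⟩ := (S.tends.eventually_gt_atTop t).exists
  refine (Set.finite_lt_nat M).subset fun i hi => ?_
  exact S.mono.lt_iff_lt.1 (lt_of_le_of_lt hi hM)

/-- The transitions into `j` up to time `t` are among the activations of `j` in `(0, t]`. -/
theorem sum_Ntrans_le_Nmode [Fintype P] (j : P) (t : ℝ) :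
    ∑ k, S.Ntrans k j t ≤ S.Nmode j 0 t := by
  classical
  have hfin : {i : ℕ | 0 < S.tau i ∧ S.tau i ≤ t ∧ S.sig (S.tau i) = j}.Finite :=
    (S.finite_setOf_tau_le t).subset fun i hi => hi.2.1
  have hF : {i : ℕ | S.tau (i + 1) ≤ t ∧ S.sig (S.tau (i + 1)) = j}.Finite :=
    (S.finite_setOf_tau_le t).subset fun i hi => (S.mono.monotone i.le_succ).trans hi.1
  have hsum : ∑ k, S.Ntrans k j t = hF.toFinset.card := by
    rw [Finset.card_eq_sum_card_fiberwise (f := fun i => S.sig (S.tau i))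
      (t := Finset.univ) fun _ _ => Finset.mem_coe.2 (Finset.mem_univ _)]
    refine Finset.sum_congr rfl fun k _ => ?_
    rw [Ntrans, ← Set.ncard_coe_finset]
    congr 1
    ext i
    simp only [Set.mem_ofPred_eq, Finset.coe_filter, Set.Finite.mem_toFinset]
    tauto
  rw [hsum, ← Set.ncard_eq_toFinset_card _ hF]
  refine Set.ncard_le_ncard_of_injOn (fun i => i + 1) (fun i hi => ⟨?_, hi.1, hi.2⟩)
    (fun _ _ _ _ h => Nat.succ_injective h) hfin
  rw [← S.tau0]
  exact S.mono i.succ_pos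

theorem T_nonneg (j : P) (s t : ℝ) : 0 ≤ S.T j s t := ENNReal.toReal_nonneg

theorem sub_le_sum_T [Fintype P] {s t : ℝ} (hst : s ≤ t) : t - s ≤ ∑ j, S.T j s t := by
  have hfin (j : P) : volume {r : ℝ | s < r ∧ r ≤ t ∧ S.sig r = j} ≠ ⊤ :=
    measure_ne_top_of_subset (show _ ⊆ Ioc s t from fun r hr => ⟨hr.1, hr.2.1⟩)
      measure_Ioc_lt_top.ne
  have hcover : Ioc s t ⊆ ⋃ j ∈ (Finset.univ : Finset P),
      {r : ℝ | s < r ∧ r ≤ t ∧ S.sig r = j} := by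
    intro r hr
    simp [hr.1, hr.2]
  have h := (measure_mono (μ := volume) hcover).trans (measure_biUnion_finset_le _ _)
  have h' := ENNReal.toReal_mono (ENNReal.sum_ne_top.2 fun j _ => hfin j) h
  rw [ENNReal.toReal_sum fun j _ => hfin j, Real.volume_Ioc,
    ENNReal.toReal_ofReal (sub_nonneg.2 hst)] at h'
  exact h'

/-- For nonnegative transition weights bounded by destination weights, the total weight of the
transitions is bounded by that of the activations. -/
theorem nu_mul_sum_rho_le [Fintype P] (E : Finset (P × P)) {a : P × P → ℝ} {c : P → ℝ}
    (hc : ∀ j, 0 ≤ c j) (ha : ∀ p ∈ E, 0 ≤ a p) (hac : ∀ p ∈ E, a p ≤ c p.2)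
    {t : ℝ} (ht : 0 < t) :
    S.nu t * ∑ p ∈ E, a p * S.rho p.1 p.2 t ≤ (∑ j, c j * S.Nmode j 0 t) / t := by
  calc S.nu t * ∑ p ∈ E, a p * S.rho p.1 p.2 t
      ≤ ∑ p ∈ E, a p * S.Ntrans p.1 p.2 t / t := by
        rw [Finset.mul_sum]
        refine Finset.sum_le_sum fun p hp => ?_
        have hnonneg : 0 ≤ a p * S.Ntrans p.1 p.2 t / t :=
          div_nonneg (mul_nonneg (ha p hp) (Nat.cast_nonneg _)) ht.le
        unfold nu rho
        by_cases hN : (S.N 0 t : ℝ) = 0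
        · simpa [hN] using hnonneg
        · apply le_of_eq
          field_simp
    _ ≤ ∑ p ∈ E, c p.2 * S.Ntrans p.1 p.2 t / t := by
        refine Finset.sum_le_sum fun p hp => ?_
        gcongr
        exact hac p hp
    _ ≤ ∑ p : P × P, c p.2 * S.Ntrans p.1 p.2 t / t :=
        Finset.sum_le_sum_of_subset_of_nonneg (Finset.subset_univ _) fun p _ _ =>
          div_nonneg (mul_nonneg (hc _) (Nat.cast_nonneg _)) ht.le
    _ = (∑ j, c j * ((∑ k, S.Ntrans k j t : ℕ) : ℝ)) / t := by
        rw [Fintype.sum_prod_type_right, Finset.sum_div]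
        refine Finset.sum_congr rfl fun j _ => ?_
        push_cast
        rw [Finset.mul_sum, Finset.sum_div]
    _ ≤ (∑ j, c j * S.Nmode j 0 t) / t := by
        gcongr with j _
        · exact hc j
        · exact S.sum_Ntrans_le_Nmode j t

end SwitchSig

theorem stmt7 {P : Type*} [Fintype P]
    (S : SwitchSig P) (Eadm : Finset (P × P))
    (lam : P → ℝ) (mu : P → P → ℝ) (mud : P → ℝ)
    (hadm : ∀ i : ℕ, (S.sig (S.tau i), S.sig (S.tau (i + 1))) ∈ Eadm)
    -- `P_U = ∅` : every subsystem is stable, `lam j > 0` for all `j`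
    (hlam : ∀ j : P, 0 < lam j)
    (hmu : ∀ p ∈ Eadm, 1 ≤ mu p.1 p.2)
    -- the jump constant depends only on the destination subsystem
    (hmud : ∀ p ∈ Eadm, mu p.1 p.2 = mud p.2)
    (N0 taua : P → ℝ) (hN0 : ∀ j : P, 0 < N0 j) (htaua : ∀ j : P, 0 < taua j)
    (hmdADT : ∀ j : P, ∀ s t : ℝ, 0 ≤ s → s < t →
        (S.Nmode j s t : ℝ) ≤ N0 j + S.T j s t / taua j)
    (htbig : ∀ j : P, Real.log (mud j) / lam j < taua j) :
    Filter.limsup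
      (fun t : ℝ =>
        ((S.nu t * ∑ p ∈ Eadm, Real.log (mu p.1 p.2) * S.rho p.1 p.2 t
            - ∑ j : P, |lam j| * S.eta j t : ℝ) : EReal))
      Filter.atTop < (0 : EReal) := by
  have : Nonempty P := ⟨S.sig 0⟩
  let c : P → ℝ := fun j => max 0 (Real.log (mud j))
  have hc (j : P) : 0 ≤ c j := le_max_left _ _
  have hgap (j : P) : 0 < lam j - c j / taua j := by
    have h : c j < taua j * lam j :=
      max_lt (mul_pos (htaua j) (hlam j)) ((div_lt_iff₀ (hlam j)).1 (htbig j))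
    rw [sub_pos, div_lt_iff₀ (htaua j), mul_comm]
    exact h
  obtain ⟨δ, hδ, hδle⟩ : ∃ δ > 0, ∀ j, δ ≤ lam j - c j / taua j := by
    obtain ⟨j₀, hj₀⟩ := Finite.exists_min fun j => lam j - c j / taua j
    exact ⟨_, hgap j₀, hj₀⟩
  have hbound (t : ℝ) (ht : 0 < t) :
      S.nu t * ∑ p ∈ Eadm, Real.log (mu p.1 p.2) * S.rho p.1 p.2 t
        - ∑ j : P, |lam j| * S.eta j t ≤ (∑ j, c j * N0 j) / t - δ := by
    have h₁ := S.nu_mul_sum_rho_le Eadm (a := fun p => Real.log (mu p.1 p.2)) hc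
      (fun p hp => Real.log_nonneg (hmu p hp))
      (fun p hp => by simp only [hmud p hp]; exact le_max_right _ _) ht
    have h₂ : ∑ j, |lam j| * S.eta j t = (∑ j, lam j * S.T j 0 t) / t := by
      rw [Finset.sum_div]
      refine Finset.sum_congr rfl fun j _ => ?_
      rw [abs_of_pos (hlam j), SwitchSig.eta, mul_div_assoc]
    have h₃ : ∑ j, c j * S.Nmode j 0 t + ∑ j, δ * S.T j 0 t
        ≤ ∑ j, c j * N0 j + ∑ j, lam j * S.T j 0 t := by
      rw [← Finset.sum_add_distrib, ← Finset.sum_add_distrib]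
      refine Finset.sum_le_sum fun j _ => ?_
      have hN := mul_le_mul_of_nonneg_left (hmdADT j 0 t le_rfl ht) (hc j)
      have hT := mul_le_mul_of_nonneg_right (hδle j) (S.T_nonneg j 0 t)
      have heq : c j * (N0 j + S.T j 0 t / taua j)
          = c j * N0 j + c j / taua j * S.T j 0 t := by ring
      linarith
    have h₄ : δ * t ≤ ∑ j, δ * S.T j 0 t := by
      rw [← Finset.mul_sum]
      have h := S.sub_le_sum_T ht.le
      rw [sub_zero] at h
      exact mul_le_mul_of_nonneg_left h hδ.le
    rw [h₂]
    refine (sub_le_sub_right h₁ _).trans ?_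
    rw [← sub_div, div_sub' ht.ne', div_le_div_iff_of_pos_right ht]
    linarith
  have hev : ∀ᶠ t : ℝ in atTop, (∑ j, c j * N0 j) / t < δ / 2 :=
    (tendsto_const_nhds.div_atTop tendsto_id).eventually_lt_const (half_pos hδ)
  refine lt_of_le_of_lt (b := ((-(δ / 2) : ℝ) : EReal)) ?_
    (EReal.coe_lt_coe_iff.2 (neg_lt_zero.2 (half_pos hδ)))
  refine limsup_le_of_le (h := ?_)
  filter_upwards [hev, eventually_gt_atTop 0] with t ht ht₀
  refine EReal.coe_le_coe_iff.2 ((hbound t ht₀).trans ?_)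
  linarith
end
end

section
/- There exists a strictly increasing sequence of switching instants 0 < τ_1 < τ_2 < ⋯ with τ_i → +∞ such that, with N(0,t) := |{ i ≥ 1 : τ_i ≤ t }|, one has liminf_{t→+∞} N(0,t)/t ≥ 1, while limsup_{t→+∞} (t − τ_{N(0,t)})/t ≥ 1/2; in particular, the condition liminf_{t→+∞} N(0,t)/t > 0 does not imply that (t − τ_{N(0,t)})/t → 0 as t → +∞. -/
open Filter

noncomputable section

/-- The number of switching instants `tau i`, `i ≥ 1`, occurring up to time `t`. -/
def numSw (tau : ℕ → ℝ) (t : ℝ) : ℕ := Set.ncard {i : ℕ | 1 ≤ i ∧ tau i ≤ t}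

theorem numSw_eq {tau : ℕ → ℝ} (hmono : StrictMono tau) {t : ℝ} {n : ℕ}
    (h₁ : tau n ≤ t) (h₂ : t < tau (n + 1)) : numSw tau t = n := by
  have hset : {i : ℕ | 1 ≤ i ∧ tau i ≤ t} = ((Finset.Icc 1 n : Finset ℕ) : Set ℕ) := by
    ext i
    simp only [Set.mem_ofPred_eq, Finset.coe_Icc, Set.mem_Icc, and_congr_right_iff]
    intro _
    refine ⟨fun hi => ?_, fun hi => (hmono.monotone hi).trans h₁⟩
    exact Nat.lt_succ_iff.1 (hmono.lt_iff_lt.1 (hi.trans_lt h₂))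
  rw [numSw, hset, Set.ncard_coe_finset, Nat.card_Icc, Nat.add_sub_cancel]

theorem exists_le_lt_succ_of_tendsto_atTop {tau : ℕ → ℝ} (htop : Tendsto tau atTop atTop)
    {t : ℝ} (ht : tau 0 ≤ t) : ∃ n, tau n ≤ t ∧ t < tau (n + 1) := by
  by_contra! h
  have hle : ∀ n, tau n ≤ t := fun n => Nat.rec ht (fun n hn => h n hn) n
  obtain ⟨n, hn⟩ := (htop.eventually_gt_atTop t).exists
  exact absurd (hle n) hn.not_ge

/-- Switching instants that cluster just after the powers of `3`: those with index in
`[3 ^ k, 3 ^ (k + 1))` lie in `[3 ^ k, 3 ^ k + 2)`. -/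
def clusteredInstant (n : ℕ) : ℝ := 3 ^ Nat.log 3 n - 1 + n / 3 ^ Nat.log 3 n

theorem clusteredInstant_zero : clusteredInstant 0 = 0 := by
  simp [clusteredInstant]

theorem clusteredInstant_of_mem {k n : ℕ} (h₁ : 3 ^ k ≤ n) (h₂ : n < 3 ^ (k + 1)) :
    clusteredInstant n = 3 ^ k - 1 + n / 3 ^ k := by
  rw [clusteredInstant, Nat.log_eq_of_pow_le_of_lt_pow h₁ h₂]

theorem clusteredInstant_pow (k : ℕ) : clusteredInstant (3 ^ k) = 3 ^ k := by
  rw [clusteredInstant_of_mem le_rfl (Nat.pow_lt_pow_right (by norm_num) k.lt_succ_self)]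
  simp

theorem strictMono_clusteredInstant : StrictMono clusteredInstant := by
  refine strictMono_nat_of_lt_succ fun n => ?_
  have hlt : n < 3 ^ (Nat.log 3 n + 1) := Nat.lt_pow_succ_log_self (by norm_num) n
  have hpos : (1 : ℝ) ≤ 3 ^ Nat.log 3 n := one_le_pow₀ (by norm_num)
  rcases (Nat.succ_le_of_lt hlt).lt_or_eq with h | h
  · have hle : 3 ^ Nat.log 3 n ≤ n + 1 := by
      rcases n.eq_zero_or_pos with rfl | hn
      · simp
      · exact (Nat.pow_log_le_self 3 hn.ne').trans n.le_succ
    rw [clusteredInstant_of_mem hle h, clusteredInstant]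
    push_cast
    gcongr
    linarith
  · have hcast : (n : ℝ) + 1 = 3 * 3 ^ Nat.log 3 n := by
      rw [← pow_succ']
      exact_mod_cast h
    have hsucc : clusteredInstant (n + 1) = 3 ^ (Nat.log 3 n + 1) :=
      (congrArg clusteredInstant h).trans (clusteredInstant_pow _)
    have hdiv : (n : ℝ) / 3 ^ Nat.log 3 n < 3 := by
      rw [div_lt_iff₀ (by linarith)]
      linarith
    rw [hsucc, clusteredInstant, pow_succ]
    linarith

theorem clusteredInstant_le_self (n : ℕ) : clusteredInstant n ≤ n := by
  rcases n.eq_zero_or_pos with rfl | hn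
  · simp [clusteredInstant_zero]
  have hle : (3 : ℝ) ^ Nat.log 3 n ≤ n := mod_cast Nat.pow_log_le_self 3 hn.ne'
  have hpos : (1 : ℝ) ≤ 3 ^ Nat.log 3 n := one_le_pow₀ (by norm_num)
  rw [clusteredInstant]
  have hdiv : (n : ℝ) / 3 ^ Nat.log 3 n ≤ n - 3 ^ Nat.log 3 n + 1 := by
    rw [div_le_iff₀ (by linarith)]
    nlinarith
  linarith

theorem self_le_three_mul_clusteredInstant (n : ℕ) : (n : ℝ) ≤ 3 * clusteredInstant n := by
  rcases n.eq_zero_or_pos with rfl | hn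
  · simp [clusteredInstant_zero]
  have hle : (3 : ℝ) ^ Nat.log 3 n ≤ n := mod_cast Nat.pow_log_le_self 3 hn.ne'
  have hlt : (n : ℝ) < 3 ^ (Nat.log 3 n + 1) :=
    mod_cast Nat.lt_pow_succ_log_self (by norm_num) n
  have hpos : (1 : ℝ) ≤ 3 ^ Nat.log 3 n := one_le_pow₀ (by norm_num)
  have hdiv : 1 ≤ (n : ℝ) / 3 ^ Nat.log 3 n := by
    rwa [le_div_iff₀ (by linarith), one_mul]
  rw [clusteredInstant]
  rw [pow_succ] at hlt
  linarith

theorem tendsto_clusteredInstant : Tendsto clusteredInstant atTop atTop := by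
  refine tendsto_atTop_mono (f := fun n : ℕ => (n : ℝ) / 3) (fun n => ?_)
    (tendsto_natCast_atTop_atTop.atTop_div_const (by norm_num))
  linarith [self_le_three_mul_clusteredInstant n]

theorem numSw_clusteredInstant_bounds {t : ℝ} (ht : 0 ≤ t) :
    t - 1 ≤ numSw clusteredInstant t ∧ (numSw clusteredInstant t : ℝ) ≤ 3 * t ∧
      0 ≤ clusteredInstant (numSw clusteredInstant t) := by
  obtain ⟨n, h₁, h₂⟩ := exists_le_lt_succ_of_tendsto_atTop tendsto_clusteredInstant
    (clusteredInstant_zero.trans_le ht)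
  rw [numSw_eq strictMono_clusteredInstant h₁ h₂]
  have hsucc := clusteredInstant_le_self (n + 1)
  push_cast at hsucc
  have hself := self_le_three_mul_clusteredInstant n
  have hn : (0 : ℝ) ≤ n := n.cast_nonneg
  exact ⟨by linarith, by linarith, by linarith⟩

/-- Just before the next power of `3`, at least half of the elapsed time has been spent since the
last switching instant. -/
theorem half_le_elapsed_ratio {k : ℕ} (hk : 2 ≤ k) :
    1 / 2 ≤ ((3 ^ (k + 1) - 1 : ℝ) -
      clusteredInstant (numSw clusteredInstant (3 ^ (k + 1) - 1))) / (3 ^ (k + 1) - 1) := by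
  have h9 : (9 : ℝ) ≤ 3 ^ k := by
    calc (9 : ℝ) = 3 ^ 2 := by norm_num
      _ ≤ 3 ^ k := pow_le_pow_right₀ (by norm_num) hk
  have hone : 1 ≤ 3 ^ k := Nat.one_le_pow _ _ (by norm_num)
  obtain ⟨n, hn⟩ : ∃ n, n + 1 = 3 ^ (k + 1) := ⟨3 ^ (k + 1) - 1, by rw [pow_succ]; omega⟩
  have hcast : (n : ℝ) + 1 = 3 * 3 ^ k := by
    rw [← pow_succ']
    exact_mod_cast hn
  have hdiv : (n : ℝ) / 3 ^ k < 3 := by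
    rw [div_lt_iff₀ (by linarith)]
    linarith
  have hval : clusteredInstant n < 3 ^ k + 2 := by
    rw [clusteredInstant_of_mem (k := k) (by rw [pow_succ] at hn; omega) (by omega)]
    linarith
  have hnext : clusteredInstant (n + 1) = 3 ^ (k + 1) :=
    (congrArg clusteredInstant hn).trans (clusteredInstant_pow _)
  have hpow : (3 : ℝ) ^ (k + 1) = 3 * 3 ^ k := pow_succ' _ _
  rw [numSw_eq (n := n) strictMono_clusteredInstant (by linarith) (by linarith),
    le_div_iff₀ (by linarith)]
  linarith

theorem frequently_half_le_elapsed_ratio :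
    ∃ᶠ t : ℝ in atTop,
      1 / 2 ≤ (t - clusteredInstant (numSw clusteredInstant t)) / t := by
  have htop : Tendsto (fun k : ℕ => (3 : ℝ) ^ (k + 1) - 1) atTop atTop :=
    tendsto_atTop_add_const_right _ _
      ((tendsto_add_atTop_iff_nat 1).2 (tendsto_pow_atTop_atTop_of_one_lt (by norm_num)))
  exact htop.frequently
    ((eventually_ge_atTop 2).mono fun k hk => half_le_elapsed_ratio hk).frequently

theorem one_le_liminf_numSw_clusteredInstant :
    1 ≤ liminf (fun t : ℝ => (numSw clusteredInstant t : ℝ) / t) atTop := by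
  have hlim : Tendsto (fun t : ℝ => 1 - t⁻¹) atTop (nhds 1) := by
    simpa using tendsto_inv_atTop_zero.const_sub (1 : ℝ)
  rw [← hlim.liminf_eq]
  refine liminf_le_liminf ?_ hlim.isBoundedUnder_ge ?_
  · filter_upwards [eventually_gt_atTop 0] with t ht
    rw [le_div_iff₀ ht, sub_mul, inv_mul_cancel₀ ht.ne', one_mul]
    exact (numSw_clusteredInstant_bounds ht.le).1
  · refine IsBoundedUnder.isCoboundedUnder_ge (isBoundedUnder_of_eventually_le (a := 3) ?_)
    filter_upwards [eventually_gt_atTop 0] with t ht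
    rw [div_le_iff₀ ht]
    exact (numSw_clusteredInstant_bounds ht.le).2.1

theorem half_le_limsup_elapsed_ratio :
    1 / 2 ≤ limsup
      (fun t : ℝ => (t - clusteredInstant (numSw clusteredInstant t)) / t) atTop := by
  refine le_limsup_of_frequently_le frequently_half_le_elapsed_ratio
    (isBoundedUnder_of_eventually_le (a := 1) ?_)
  filter_upwards [eventually_gt_atTop 0] with t ht
  rw [div_le_one ht]
  linarith [(numSw_clusteredInstant_bounds ht.le).2.2]

theorem stmt15 :
    ∃ tau : ℕ → ℝ, tau 0 = 0 ∧ StrictMono tau ∧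
      Filter.Tendsto tau Filter.atTop Filter.atTop ∧
      1 ≤ Filter.liminf (fun t : ℝ => (numSw tau t : ℝ) / t) Filter.atTop ∧
      1 / 2 ≤ Filter.limsup (fun t : ℝ => (t - tau (numSw tau t)) / t) Filter.atTop ∧
      ¬ Filter.Tendsto (fun t : ℝ => (t - tau (numSw tau t)) / t)
          Filter.atTop (nhds (0 : ℝ)) := by
  refine ⟨clusteredInstant, clusteredInstant_zero, strictMono_clusteredInstant,
    tendsto_clusteredInstant, one_le_liminf_numSw_clusteredInstant,
    half_le_limsup_elapsed_ratio, fun h => ?_⟩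
  have hsmall := h.eventually_lt_const (by norm_num : (0 : ℝ) < 1 / 2)
  exact frequently_half_le_elapsed_ratio (hsmall.mono fun t ht => ht.not_ge)
end
end
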